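/- arXiv:1911.01541 — 6 statements merged into one kernel-verified Lean document; each statement's English description precedes it below -/
import Mathlib

section
/- Let S be a nonnegative real m×n matrix that is not identically zero. If S = UV for some nonnegative matrices U ∈ ℝ^{m×r} and V ∈ ℝ^{r×n} (i.e., S admits a nonnegative factorization of rank r), then hsb(S) ≤ r. In particular, the nonnegative rank of S is at least hsb(S). -/
open scoped Classical
open Matrix BigOperators

/-- The Frobenius inner product of two real matrices. -/
def frob {m n : Type*} [Fintype m] [Fintype n] (A B : Matrix m n ℝ) : ℝ :=
  ∑ i, ∑ j, A i j * B i j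

/-- The maximum absolute value of an entry of a real matrix. -/
noncomputable def mnorm {m n : Type*} [Fintype m] [Fintype n] (S : Matrix m n ℝ) : ℝ :=
  ⨆ p : m × n, |S p.1 p.2|

/-- The finite set `R_{m,n}` of rank-one 0/1 matrices. -/
noncomputable def rankOne01 (m n : Type*) [Fintype m] [Fintype n] :
    Finset (Matrix m n ℝ) :=
  ((Finset.univ : Finset (Matrix m n Bool)).image
      (fun B => Matrix.of fun i j => if B i j then (1 : ℝ) else 0)).filter
    (fun R => R.rank = 1)

/-- The hyperplane separation bound
`hsb S = ‖S‖⁻¹ ⬝ sup { ⟨S,X⟩ : ⟨X,R⟩ ≤ 1 for all rank-one 0/1 matrices R }`. -/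
noncomputable def hsb {m n : Type*} [Fintype m] [Fintype n] (S : Matrix m n ℝ) : ℝ :=
  (mnorm S)⁻¹ *
    sSup {t : ℝ | ∃ X : Matrix m n ℝ,
      (∀ R ∈ rankOne01 m n, frob X R ≤ 1) ∧ t = frob S X}

/-- A linear form on the box `[0, a] ^ ι` is at most `a` times its sum over some subset of
indices. -/
lemma exists_sum_mul_le_mul_sum {ι : Type*} [Fintype ι] {a : ℝ} {u : ι → ℝ}
    (hu : ∀ i, 0 ≤ u i) (hua : ∀ i, u i ≤ a) (w : ι → ℝ) :
    ∃ A : Finset ι, ∑ i, u i * w i ≤ a * ∑ i ∈ A, w i := by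
  refine ⟨Finset.univ.filter fun i => 0 ≤ w i, ?_⟩
  rw [Finset.mul_sum, Finset.sum_filter]
  refine Finset.sum_le_sum fun i _ => ?_
  split_ifs with h
  · exact mul_le_mul_of_nonneg_right (hua i) h
  · exact mul_nonpos_of_nonneg_of_nonpos (hu i) (not_le.mp h).le

/-- The indicator matrix of a nonempty combinatorial rectangle is a rank-one 0/1 matrix. -/
lemma indicator_mem_rankOne01 {m n : Type*} [Fintype m] [Fintype n] {A : Finset m}
    {B : Finset n} (hA : A.Nonempty) (hB : B.Nonempty) :
    (Matrix.of fun i j => if i ∈ A ∧ j ∈ B then (1 : ℝ) else 0) ∈ rankOne01 m n := by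
  refine Finset.mem_filter.mpr ⟨Finset.mem_image.mpr
    ⟨fun i j => decide (i ∈ A ∧ j ∈ B), Finset.mem_univ _, by ext i j; simp⟩, ?_⟩
  obtain ⟨i, hi⟩ := hA
  obtain ⟨j, hj⟩ := hB
  refine le_antisymm ?_ (Nat.one_le_iff_ne_zero.mpr fun h => ?_)
  · have h : (Matrix.of fun i j => if i ∈ A ∧ j ∈ B then (1 : ℝ) else 0) =
        vecMulVec (fun i => if i ∈ A then 1 else 0) (fun j => if j ∈ B then 1 else 0) := by
      ext i j
      by_cases hi : i ∈ A <;> by_cases hj : j ∈ B <;> simp [vecMulVec_apply, hi, hj]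
    rw [h]
    exact rank_vecMulVec_le _ _
  · have h0 := congrFun (LinearMap.congr_fun
      (LinearMap.range_eq_bot.mp (Submodule.finrank_eq_zero.mp h)) (Pi.single j 1)) i
    simp [hi, hj] at h0

/-- A matrix satisfying the constraints of the hyperplane separation bound has sum at most `1`
over every combinatorial rectangle. -/
lemma sum_rectangle_le_one {m n : Type*} [Fintype m] [Fintype n] {X : Matrix m n ℝ}
    (hX : ∀ R ∈ rankOne01 m n, frob X R ≤ 1) (A : Finset m) (B : Finset n) :
    ∑ i ∈ A, ∑ j ∈ B, X i j ≤ 1 := by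
  rcases A.eq_empty_or_nonempty with rfl | hA
  · simp
  rcases B.eq_empty_or_nonempty with rfl | hB
  · simp
  have h := hX _ (indicator_mem_rankOne01 hA hB)
  simpa [frob, ite_and, Finset.sum_ite_mem, ← Finset.sum_filter] using h

lemma sum_mul_mul_le {m n : Type*} [Fintype m] [Fintype n] {X : Matrix m n ℝ}
    (hX : ∀ R ∈ rankOne01 m n, frob X R ≤ 1) {u : m → ℝ} {v : n → ℝ} {a b : ℝ}
    (ha : 0 ≤ a) (hb : 0 ≤ b) (hu : ∀ i, 0 ≤ u i) (hua : ∀ i, u i ≤ a)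
    (hv : ∀ j, 0 ≤ v j) (hvb : ∀ j, v j ≤ b) :
    ∑ i, ∑ j, u i * v j * X i j ≤ a * b := by
  obtain ⟨A, hA⟩ := exists_sum_mul_le_mul_sum hu hua fun i => ∑ j, v j * X i j
  obtain ⟨B, hB⟩ := exists_sum_mul_le_mul_sum hv hvb fun j => ∑ i ∈ A, X i j
  calc ∑ i, ∑ j, u i * v j * X i j = ∑ i, u i * ∑ j, v j * X i j := by
        simp only [Finset.mul_sum, mul_assoc]
    _ ≤ a * ∑ i ∈ A, ∑ j, v j * X i j := hA
    _ = a * ∑ j, v j * ∑ i ∈ A, X i j := by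
        rw [Finset.sum_comm]
        simp only [Finset.mul_sum]
    _ ≤ a * (b * ∑ j ∈ B, ∑ i ∈ A, X i j) := mul_le_mul_of_nonneg_left hB ha
    _ ≤ a * (b * 1) := by
        rw [Finset.sum_comm]
        gcongr
        exact sum_rectangle_le_one hX A B
    _ = a * b := by ring

lemma abs_le_mnorm {m n : Type*} [Fintype m] [Fintype n] (S : Matrix m n ℝ) (i : m) (j : n) :
    |S i j| ≤ mnorm S :=
  le_ciSup (f := fun p : m × n => |S p.1 p.2|) (Set.finite_range _).bddAbove (i, j)

/-- If a nonnegative, not identically zero matrix `S` admits a nonnegative factorization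
`S = U * V` of rank `r`, then `hsb S ≤ r`.  In particular `hsb S` is a lower bound on the
nonnegative rank of `S`. -/
theorem hsb_le_of_nonneg_factorization {m n r : ℕ}
    (S : Matrix (Fin m) (Fin n) ℝ) (hS : ∀ i j, 0 ≤ S i j) (hS0 : S ≠ 0)
    (U : Matrix (Fin m) (Fin r) ℝ) (V : Matrix (Fin r) (Fin n) ℝ)
    (hU : ∀ i k, 0 ≤ U i k) (hV : ∀ k j, 0 ≤ V k j) (hUV : S = U * V) :
    hsb S ≤ (r : ℝ) := by
  obtain ⟨i₀, j₀, hij⟩ : ∃ i j, S i j ≠ 0 := by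
    by_contra! h
    exact hS0 (Matrix.ext h)
  have hpos : 0 < mnorm S := (abs_pos.mpr hij).trans_le (abs_le_mnorm S i₀ j₀)
  have : Nonempty (Fin m) := ⟨i₀⟩
  have : Nonempty (Fin n) := ⟨j₀⟩
  rw [hsb, inv_mul_le_iff₀ hpos]
  refine Real.sSup_le ?_ (by positivity)
  rintro t ⟨X, hX, rfl⟩
  have hk : ∀ k, ∑ i, ∑ j, U i k * V k j * X i j ≤ mnorm S := by
    intro k
    obtain ⟨i, hi⟩ := Finite.exists_max fun i => U i k
    obtain ⟨j, hj⟩ := Finite.exists_max fun j => V k j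
    calc ∑ i, ∑ j, U i k * V k j * X i j ≤ U i k * V k j :=
          sum_mul_mul_le hX (hU i k) (hV k j) (fun i => hU i k) hi (hV k) hj
      _ ≤ S i j := by
          rw [hUV, Matrix.mul_apply]
          exact Finset.single_le_sum (f := fun k => U i k * V k j)
            (fun k _ => mul_nonneg (hU i k) (hV k j)) (Finset.mem_univ k)
      _ ≤ mnorm S := (le_abs_self _).trans (abs_le_mnorm S i j)
  calc frob S X = ∑ k, ∑ i, ∑ j, U i k * V k j * X i j := by
        simp only [frob]
        rw [Finset.sum_comm (s := (Finset.univ : Finset (Fin r)))]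
        refine Finset.sum_congr rfl fun i _ => ?_
        rw [Finset.sum_comm]
        refine Finset.sum_congr rfl fun j _ => ?_
        rw [hUV, Matrix.mul_apply, Finset.sum_mul]
    _ ≤ ∑ _k : Fin r, mnorm S := Finset.sum_le_sum fun k _ => hk k
    _ = mnorm S * r := by simp [mul_comm]
end

section
/- Let S be a nonnegative real m×n matrix that is not identically zero. Then the set { ‖S‖^{-1} · Σ_{R ∈ R_{m,n}} y_R : y ∈ ℝ^{R_{m,n}}, y ≥ 0, Σ_{R ∈ R_{m,n}} y_R · R = S } is nonempty and hsb(S) equals its minimum; that is, hsb(S) = min { ‖S‖^{-1} Σ_R y_R : y ≥ 0, Σ_R y_R R = S }, and this minimum is attained. -/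
open scoped Classical
open Matrix BigOperators

/-- Strong duality for a feasible linear program `min ∑ y i` subject to `y ≥ 0` and
`∑ y i • a i = b` with bounded feasible set: the minimum is attained and equals the supremum
of the dual program. -/
theorem exists_min_isLUB_dual {ι E : Type*} [Fintype ι] [TopologicalSpace E] [AddCommGroup E]
    [Module ℝ E] [IsTopologicalAddGroup E] [ContinuousSMul ℝ E] [LocallyConvexSpace ℝ E]
    [T2Space E] (a : ι → E) (b : E) (hb : b ≠ 0) (c : ℝ)
    (hne : ∃ y : ι → ℝ, 0 ≤ y ∧ ∑ i, y i • a i = b)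
    (hbd : ∀ y : ι → ℝ, 0 ≤ y → ∑ i, y i • a i = b → ∀ i, y i ≤ c) :
    ∃ y : ι → ℝ, 0 ≤ y ∧ ∑ i, y i • a i = b ∧
      (∀ z : ι → ℝ, 0 ≤ z → ∑ i, z i • a i = b → ∑ i, y i ≤ ∑ i, z i) ∧
      IsLUB {t : ℝ | ∃ f : E →L[ℝ] ℝ, (∀ i, f (a i) ≤ 1) ∧ t = f b} (∑ i, y i) := by
  have hL : Continuous fun y : ι → ℝ => ∑ i, y i • a i := by fun_prop
  have hsum : Continuous fun y : ι → ℝ => ∑ i, y i := by fun_prop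
  have hF : IsCompact {y : ι → ℝ | 0 ≤ y ∧ ∑ i, y i • a i = b} := by
    refine (isCompact_Icc (a := (0 : ι → ℝ)) (b := fun _ => c)).of_isClosed_subset ?_ ?_
    · exact (isClosed_le continuous_const continuous_id).inter (isClosed_eq hL continuous_const)
    · rintro y ⟨h0, h1⟩
      exact ⟨h0, hbd y h0 h1⟩
  obtain ⟨y, ⟨hy0, hyb⟩, hmin⟩ := hF.exists_isMinOn hne hsum.continuousOn
  have hmin' : ∀ z : ι → ℝ, 0 ≤ z → ∑ i, z i • a i = b → ∑ i, y i ≤ ∑ i, z i :=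
    fun z h0 h1 => hmin ⟨h0, h1⟩
  refine ⟨y, hy0, hyb, hmin', ?_, ?_⟩
  · rintro _ ⟨f, hf, rfl⟩
    rw [← hyb, map_sum]
    refine Finset.sum_le_sum fun i _ => ?_
    rw [map_smul, smul_eq_mul]
    exact mul_le_of_le_one_right (hy0 i) (hf i)
  · intro u hu
    have hv : 0 < ∑ i, y i := by
      refine (Finset.sum_nonneg fun i _ => hy0 i).lt_of_ne fun h => hb ?_
      have := (Finset.sum_eq_zero_iff_of_nonneg fun i _ => hy0 i).1 h.symm
      rw [← hyb]
      exact Finset.sum_eq_zero fun i hi => by rw [this i hi, zero_smul]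
    refine le_of_forall_lt fun t' ht' => ?_
    set t := max t' ((∑ i, y i) / 2)
    have ht0 : 0 < t := lt_max_of_lt_right (half_pos hv)
    have htv : t < ∑ i, y i := max_lt ht' (half_lt_self hv)
    let D : Set (ι → ℝ) := {z | 0 ≤ z ∧ ∑ i, z i ≤ 1}
    have hD : IsCompact D := by
      refine (isCompact_Icc (a := (0 : ι → ℝ)) (b := fun _ => 1)).of_isClosed_subset ?_ ?_
      · exact (isClosed_le continuous_const continuous_id).inter
          (isClosed_le hsum continuous_const)
      · rintro z ⟨h0, h1⟩
        exact ⟨h0, fun i =>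
          (Finset.single_le_sum (fun j _ => h0 j) (Finset.mem_univ i)).trans h1⟩
    have hDc : Convex ℝ D := by
      rintro z ⟨hz0, hz1⟩ w ⟨hw0, hw1⟩ p q hp hq hpq
      refine ⟨add_nonneg (smul_nonneg hp hz0) (smul_nonneg hq hw0), ?_⟩
      simp only [Pi.add_apply, Pi.smul_apply, smul_eq_mul, Finset.sum_add_distrib,
        ← Finset.mul_sum]
      nlinarith
    let L : (ι → ℝ) →ₗ[ℝ] E := Fintype.linearCombination ℝ a
    have hLa : ∀ z, L z = ∑ i, z i • a i := fun z => Fintype.linearCombination_apply ℝ a z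
    have hKc : IsClosed (L '' D) := by
      refine (hD.image ?_).isClosed
      simpa only [← hLa] using hL
    have hnot : t⁻¹ • b ∉ L '' D := by
      rintro ⟨z, ⟨hz0, hz1⟩, hz⟩
      have h := hmin' (t • z) (smul_nonneg ht0.le hz0) (by
        rw [← hLa, map_smul, hz, smul_inv_smul₀ ht0.ne'])
      simp only [Pi.smul_apply, smul_eq_mul, ← Finset.mul_sum] at h
      nlinarith
    obtain ⟨f, s, hfs, hsb⟩ :=
      geometric_hahn_banach_closed_point (hDc.linear_image L) hKc hnot
    have hs : 0 < s := by
      have := hfs 0 ⟨0, ⟨le_rfl, by simp⟩, map_zero L⟩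
      simpa using this
    have hfa : ∀ i, f (a i) < s := fun i => by
      refine hfs _ ⟨Pi.single i 1, ⟨?_, ?_⟩, ?_⟩
      · exact Pi.single_nonneg.2 zero_le_one
      · simp
      · simp [L]
    rw [map_smul, smul_eq_mul] at hsb
    refine ((le_max_left t' ((∑ i, y i) / 2)).trans_lt ?_).trans_le (hu ⟨s⁻¹ • f, fun i => ?_, rfl⟩)
    · change t < s⁻¹ * f b
      rw [lt_inv_mul_iff₀ ht0] at hsb
      rw [lt_inv_mul_iff₀ hs]
      linarith
    · change s⁻¹ * f (a i) ≤ 1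
      rw [inv_mul_le_one₀ hs]
      exact (hfa i).le

theorem single_mem_rankOne01 {m n : Type*} [Fintype m] [Fintype n] (i : m) (j : n) :
    Matrix.single i j (1 : ℝ) ∈ rankOne01 m n := by
  refine Finset.mem_filter.2 ⟨Finset.mem_image.2
    ⟨fun k l => decide (i = k ∧ j = l), Finset.mem_univ _, ?_⟩, ?_⟩
  · ext k l
    simp [Matrix.single_apply]
  · refine le_antisymm ?_ ?_
    · rw [Matrix.single_eq_single_vecMulVec_single]
      exact Matrix.rank_vecMulVec_le _ _
    · refine Nat.one_le_iff_ne_zero.2 fun h => ?_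
      rw [Matrix.rank, Submodule.finrank_eq_zero, LinearMap.range_eq_bot] at h
      simpa using congrFun (LinearMap.congr_fun h (Pi.single j 1)) i

theorem nonneg_of_mem_rankOne01 {m n : Type*} [Fintype m] [Fintype n] {R : Matrix m n ℝ}
    (hR : R ∈ rankOne01 m n) (i : m) (j : n) : 0 ≤ R i j := by
  obtain ⟨B, -, rfl⟩ := Finset.mem_image.1 (Finset.mem_filter.1 hR).1
  simp only [Matrix.of_apply]
  split_ifs <;> norm_num

theorem exists_eq_one_of_mem_rankOne01 {m n : Type*} [Fintype m] [Fintype n]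
    {R : Matrix m n ℝ} (hR : R ∈ rankOne01 m n) : ∃ i j, R i j = 1 := by
  obtain ⟨hB, hrank⟩ := Finset.mem_filter.1 hR
  obtain ⟨B, -, rfl⟩ := Finset.mem_image.1 hB
  by_contra! h
  have h0 : (Matrix.of fun i j => if B i j then (1 : ℝ) else 0) = 0 := by
    ext i j
    have := h i j
    simp only [Matrix.of_apply] at this ⊢
    split_ifs at this ⊢
    · exact absurd rfl this
    · rfl
  rw [h0, Matrix.rank_zero] at hrank
  exact zero_ne_one hrank

theorem exists_nonneg_sum_rankOne01_eq {m n : Type*} [Fintype m] [Fintype n]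
    (S : Matrix m n ℝ) (hS : ∀ i j, 0 ≤ S i j) :
    ∃ y : Matrix m n ℝ → ℝ, (∀ R, 0 ≤ y R) ∧ ∑ R ∈ rankOne01 m n, y R • R = S := by
  refine ⟨fun R => ∑ i, ∑ j, if R = Matrix.single i j 1 then S i j else 0,
    fun R => Finset.sum_nonneg fun i _ => Finset.sum_nonneg fun j _ => ?_, ?_⟩
  · split_ifs
    exacts [hS i j, le_rfl]
  · simp only [Finset.sum_smul]
    rw [Finset.sum_comm]
    conv_rhs => rw [Matrix.matrix_eq_sum_single S]
    refine Finset.sum_congr rfl fun i _ => ?_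
    rw [Finset.sum_comm]
    refine Finset.sum_congr rfl fun j _ => ?_
    simp only [ite_smul, zero_smul, Finset.sum_ite_eq', single_mem_rankOne01, if_true]
    simp

theorem le_sum_of_sum_rankOne01_eq {m n : Type*} [Fintype m] [Fintype n]
    {S : Matrix m n ℝ} (hS : ∀ i j, 0 ≤ S i j) {y : rankOne01 m n → ℝ} (hy : 0 ≤ y)
    (h : ∑ R, y R • (R : Matrix m n ℝ) = S) (R : rankOne01 m n) :
    y R ≤ ∑ i, ∑ j, S i j := by
  obtain ⟨i, j, hij⟩ := exists_eq_one_of_mem_rankOne01 R.2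
  calc y R = y R * (R : Matrix m n ℝ) i j := by rw [hij, mul_one]
    _ ≤ ∑ Q, y Q * (Q : Matrix m n ℝ) i j :=
        Finset.single_le_sum (f := fun Q : rankOne01 m n => y Q * (Q : Matrix m n ℝ) i j)
          (fun Q _ => mul_nonneg (hy Q) (nonneg_of_mem_rankOne01 Q.2 i j)) (Finset.mem_univ R)
    _ = S i j := by rw [← h]; simp [Matrix.sum_apply]
    _ ≤ ∑ l, S i l := Finset.single_le_sum (fun l _ => hS i l) (Finset.mem_univ j)
    _ ≤ ∑ k, ∑ l, S k l := Finset.single_le_sum (f := fun k => ∑ l, S k l)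
        (fun k _ => Finset.sum_nonneg fun l _ => hS k l) (Finset.mem_univ i)

theorem frob_comm {m n : Type*} [Fintype m] [Fintype n] (A B : Matrix m n ℝ) :
    frob A B = frob B A := by
  simp only [frob, mul_comm]

/-- Continuous linear functionals on matrices are Frobenius products with a matrix. -/
theorem exists_clm_iff_exists_frob {m n : Type*} [Fintype m] [Fintype n]
    (P : (Matrix m n ℝ → ℝ) → Prop) :
    (∃ f : Matrix m n ℝ →L[ℝ] ℝ, P f) ↔ ∃ X : Matrix m n ℝ, P (frob X) := by
  constructor
  · rintro ⟨f, hf⟩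
    refine ⟨Matrix.of fun i j => f (Matrix.single i j 1), ?_⟩
    convert hf using 1
    funext A
    conv_rhs => rw [Matrix.matrix_eq_sum_single A]
    simp only [map_sum, frob, Matrix.of_apply]
    refine Finset.sum_congr rfl fun i _ => Finset.sum_congr rfl fun j _ => ?_
    rw [mul_comm, ← smul_eq_mul, ← map_smul, Matrix.smul_single, smul_eq_mul, mul_one]
  · rintro ⟨X, hX⟩
    refine ⟨⟨⟨⟨frob X, fun A B => ?_⟩, fun c A => ?_⟩, ?_⟩, hX⟩
    · simp [frob, mul_add, Finset.sum_add_distrib]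
    · simp [frob, Finset.mul_sum, mul_left_comm]
    · change Continuous fun A : Matrix m n ℝ => ∑ i, ∑ j, X i j * A i j
      fun_prop

/-- Dual characterization of the hyperplane separation bound: `hsb S` is the minimum of
`‖S‖⁻¹ ∑ y_R` over all nonnegative weightings `y` of the rank-one 0/1 matrices with
`∑ y_R • R = S`, and this minimum is attained. -/
theorem hsb_eq_min_dual {m n : ℕ}
    (S : Matrix (Fin m) (Fin n) ℝ) (hS : ∀ i j, 0 ≤ S i j) (hS0 : S ≠ 0) :
    IsLeast {t : ℝ | ∃ y : Matrix (Fin m) (Fin n) ℝ → ℝ,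
        (∀ R, 0 ≤ y R) ∧
        (∑ R ∈ rankOne01 (Fin m) (Fin n), y R • R) = S ∧
        t = (mnorm S)⁻¹ * ∑ R ∈ rankOne01 (Fin m) (Fin n), y R}
      (hsb S) := by
  have : LocallyConvexSpace ℝ (Matrix (Fin m) (Fin n) ℝ) :=
    inferInstanceAs (LocallyConvexSpace ℝ (Fin m → Fin n → ℝ))
  obtain ⟨y, hy0, hyS, hmin, hlub⟩ := exists_min_isLUB_dual
    (fun R : rankOne01 (Fin m) (Fin n) => (R : Matrix (Fin m) (Fin n) ℝ)) S hS0
    (∑ i, ∑ j, S i j)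
    (by
      obtain ⟨y, hy0, hyS⟩ := exists_nonneg_sum_rankOne01_eq S hS
      exact ⟨fun R => y R, fun R => hy0 R,
        (Finset.sum_coe_sort (rankOne01 (Fin m) (Fin n)) fun R => y R • R).trans hyS⟩)
    (fun y hy h => le_sum_of_sum_rankOne01_eq hS hy h)
  have hset : {t : ℝ | ∃ X : Matrix (Fin m) (Fin n) ℝ,
      (∀ R ∈ rankOne01 (Fin m) (Fin n), frob X R ≤ 1) ∧ t = frob S X} =
      {t : ℝ | ∃ f : Matrix (Fin m) (Fin n) ℝ →L[ℝ] ℝ,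
        (∀ R : rankOne01 (Fin m) (Fin n), f R ≤ 1) ∧ t = f S} := by
    ext t
    simp only [Set.mem_ofPred_eq]
    rw [exists_clm_iff_exists_frob fun g =>
      (∀ R : rankOne01 (Fin m) (Fin n), g R ≤ 1) ∧ t = g S]
    simp only [frob_comm S, Subtype.forall]
  have hhsb : hsb S = (mnorm S)⁻¹ * ∑ R, y R := by
    rw [hsb, hset, hlub.csSup_eq ⟨0, 0, fun _ => zero_le_one, rfl⟩]
  rw [hhsb]
  constructor
  · refine ⟨fun R => if h : R ∈ rankOne01 (Fin m) (Fin n) then y ⟨R, h⟩ else 0,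
      fun R => ?_, ?_, ?_⟩
    · dsimp only
      split_ifs with h
      exacts [hy0 _, le_rfl]
    · rw [← Finset.sum_coe_sort]
      simpa using hyS
    · rw [← Finset.sum_coe_sort (rankOne01 (Fin m) (Fin n))]
      simp only [Finset.coe_mem, dif_pos, Subtype.coe_eta]
  · rintro _ ⟨z, hz0, hzS, rfl⟩
    refine mul_le_mul_of_nonneg_left ?_
      (inv_nonneg.2 (Real.iSup_nonneg fun _ => abs_nonneg _))
    rw [← Finset.sum_coe_sort _ z]
    refine hmin (fun R => z R) (fun R => hz0 R) ?_
    exact (Finset.sum_coe_sort _ fun R => z R • R).trans hzS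
end

section
/- Let S be a nonnegative real m×n matrix that is not identically zero. If S = UV where U ∈ {0,1}^{m×r} and V ∈ {0,1}^{r×n} are 0/1 matrices, then hsb(S) ≤ r / ‖S‖. -/
open scoped Classical
open Matrix BigOperators

/-- A 0/1 outer product is either zero or a rank-one 0/1 matrix. -/
theorem vecMulVec_eq_zero_or_mem_rankOne01 {m n : Type*} [Fintype m] [Fintype n]
    {u : m → ℝ} {v : n → ℝ} (hu : ∀ i, u i = 0 ∨ u i = 1) (hv : ∀ j, v j = 0 ∨ v j = 1) :
    vecMulVec u v = 0 ∨ vecMulVec u v ∈ rankOne01 m n := by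
  refine or_iff_not_imp_left.mpr fun hne => ?_
  unfold rankOne01
  refine Finset.mem_filter.mpr ⟨Finset.mem_image.mpr
    ⟨fun i j => decide (u i = 1 ∧ v j = 1), Finset.mem_univ _, ?_⟩, ?_⟩
  · ext i j
    rcases hu i with h | h <;> rcases hv j with h' | h' <;> simp [vecMulVec_apply, h, h']
  · refine le_antisymm (rank_vecMulVec_le u v) (Nat.one_le_iff_ne_zero.mpr fun h0 => hne ?_)
    rw [Matrix.rank, Submodule.finrank_eq_zero, LinearMap.range_eq_bot] at h0
    exact Matrix.mulVec_injective (funext fun x => LinearMap.congr_fun h0 x |>.trans (by simp))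

/-- The Frobenius inner product with a matrix product splits into outer products. -/
theorem frob_mul_eq_sum {m n k : Type*} [Fintype m] [Fintype n] [Fintype k]
    (U : Matrix m k ℝ) (V : Matrix k n ℝ) (X : Matrix m n ℝ) :
    frob (U * V) X = ∑ l, frob X (vecMulVec (fun i => U i l) (V l)) := by
  simp only [frob, Matrix.mul_apply, vecMulVec_apply, Finset.sum_mul]
  simp_rw [mul_comm (X _ _)]
  rw [Finset.sum_comm (s := (Finset.univ : Finset k))]
  exact Finset.sum_congr rfl fun i _ => Finset.sum_comm

/-- If a nonnegative, not identically zero matrix `S` admits a nonnegative factorization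
`S = U * V` of rank `r` whose factors are 0/1 matrices, then `hsb S ≤ r / ‖S‖`. -/
theorem hsb_le_of_zeroOne_factorization {m n r : ℕ}
    (S : Matrix (Fin m) (Fin n) ℝ) (hS : ∀ i j, 0 ≤ S i j) (hS0 : S ≠ 0)
    (U : Matrix (Fin m) (Fin r) ℝ) (V : Matrix (Fin r) (Fin n) ℝ)
    (hU : ∀ i k, U i k = 0 ∨ U i k = 1) (hV : ∀ k j, V k j = 0 ∨ V k j = 1)
    (hUV : S = U * V) :
    hsb S ≤ (r : ℝ) / mnorm S := by
  have hnorm : 0 ≤ mnorm S := Real.iSup_nonneg fun _ => abs_nonneg _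
  rw [hsb, div_eq_inv_mul]
  refine mul_le_mul_of_nonneg_left (Real.sSup_le ?_ r.cast_nonneg) (inv_nonneg.mpr hnorm)
  rintro _ ⟨X, hX, rfl⟩
  rw [hUV, frob_mul_eq_sum]
  have hterm : ∀ k ∈ Finset.univ, frob X (vecMulVec (fun i => U i k) (V k)) ≤ 1 := by
    intro k _
    rcases vecMulVec_eq_zero_or_mem_rankOne01 (fun i => hU i k) (hV k) with h | h
    · simp [h, frob]
    · exact hX _ h
  simpa using Finset.sum_le_sum hterm
end

section
/- Let S be a nonnegative real m×n matrix that is not identically zero, and let D₁ (m×m) and D₂ (n×n) be diagonal matrices with strictly positive diagonal entries. Then (‖S‖ / (‖D₁⁻¹‖ · ‖D₁ S D₂‖ · ‖D₂⁻¹‖)) · hsb(S) ≤ hsb(D₁ S D₂) ≤ hsb(S) · (‖D₁‖ · ‖S‖ · ‖D₂‖) / ‖D₁ S D₂‖. -/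
open scoped Classical
open Matrix BigOperators

lemma frob_smul_right {m n : Type*} [Fintype m] [Fintype n] (c : ℝ) (A B : Matrix m n ℝ) :
    frob A (c • B) = c * frob A B := by
  simp only [frob, Finset.mul_sum, Matrix.smul_apply, smul_eq_mul]
  exact Finset.sum_congr rfl fun i _ => Finset.sum_congr rfl fun j _ => by ring

lemma frob_vecMulVec {m n : Type*} [Fintype m] [Fintype n] (X : Matrix m n ℝ)
    (x : m → ℝ) (y : n → ℝ) : frob X (vecMulVec x y) = ∑ i, x i * ∑ j, X i j * y j := by
  simp only [frob, Finset.mul_sum, vecMulVec_apply]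
  exact Finset.sum_congr rfl fun i _ => Finset.sum_congr rfl fun j _ => by ring

lemma frob_vecMulVec' {m n : Type*} [Fintype m] [Fintype n] (X : Matrix m n ℝ)
    (x : m → ℝ) (y : n → ℝ) : frob X (vecMulVec x y) = ∑ j, y j * ∑ i, X i j * x i := by
  rw [frob, Finset.sum_comm]
  simp only [Finset.mul_sum, vecMulVec_apply]
  exact Finset.sum_congr rfl fun i _ => Finset.sum_congr rfl fun j _ => by ring

lemma frob_diagonal_mul_mul_diagonal {m n : Type*} [Fintype m] [Fintype n]
    [DecidableEq m] [DecidableEq n] (A B : Matrix m n ℝ) (d : m → ℝ) (e : n → ℝ) :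
    frob (diagonal d * A * diagonal e) B = frob A (diagonal d * B * diagonal e) := by
  simp only [frob, mul_diagonal, diagonal_mul]
  exact Finset.sum_congr rfl fun i _ => Finset.sum_congr rfl fun j _ => by ring

lemma le_mnorm_diagonal {m : Type*} [Fintype m] [DecidableEq m] (d : m → ℝ) (i : m) :
    d i ≤ mnorm (diagonal d) := by
  simpa using (le_abs_self _).trans (abs_le_mnorm (diagonal d) i i)

lemma mnorm_pos {m n : Type*} [Fintype m] [Fintype n] {S : Matrix m n ℝ} {i : m} {j : n}
    (h : S i j ≠ 0) : 0 < mnorm S :=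
  (abs_pos.2 h).trans_le (abs_le_mnorm S i j)

/-- A linear form on the cube `[0,1]^m` is bounded by its value at some vertex. -/
lemma exists_vertex_ge {m : Type*} [Fintype m] (c x : m → ℝ) (h0 : ∀ i, 0 ≤ x i)
    (h1 : ∀ i, x i ≤ 1) :
    ∃ p : m → Prop, ∑ i, x i * c i ≤ ∑ i, (if p i then 1 else 0) * c i := by
  refine ⟨fun i => 0 ≤ c i, Finset.sum_le_sum fun i _ => ?_⟩
  by_cases h : 0 ≤ c i
  · simpa [h] using mul_le_of_le_one_left h (h1 i)
  · simpa [h] using mul_nonpos_of_nonneg_of_nonpos (h0 i) (not_le.1 h).le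

lemma vecMulVec_indicator_mem_rankOne01 {m n : Type*} [Fintype m] [Fintype n]
    (p : m → Prop) (q : n → Prop) {i : m} {j : n} (hi : p i) (hj : q j) :
    vecMulVec (fun i => if p i then (1 : ℝ) else 0) (fun j => if q j then (1 : ℝ) else 0) ∈
      rankOne01 m n := by
  refine Finset.mem_filter.2 ⟨Finset.mem_image.2
    ⟨fun i j => decide (p i) && decide (q j), Finset.mem_univ _, ?_⟩, ?_⟩
  · ext i j
    by_cases hi : p i <;> by_cases hj : q j <;> simp [vecMulVec_apply, hi, hj]
  · refine le_antisymm (rank_vecMulVec_le _ _) (Nat.one_le_iff_ne_zero.2 fun h => ?_)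
    rw [Matrix.rank, Submodule.finrank_eq_zero, LinearMap.range_eq_bot] at h
    have := congrFun (LinearMap.congr_fun h (Pi.single j 1)) i
    simp [vecMulVec_apply, hi, hj] at this

/-- Every rank-one 0/1 matrix is the indicator matrix of a combinatorial rectangle. -/
lemma exists_eq_vecMulVec_of_mem_rankOne01 {m n : Type*} [Fintype m] [Fintype n]
    {R : Matrix m n ℝ} (hR : R ∈ rankOne01 m n) :
    ∃ (p : m → Prop) (q : n → Prop), R =
      vecMulVec (fun i => if p i then (1 : ℝ) else 0) (fun j => if q j then (1 : ℝ) else 0) := by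
  obtain ⟨hB, hr⟩ := Finset.mem_filter.1 hR
  obtain ⟨B, -, rfl⟩ := Finset.mem_image.1 hB
  set R : Matrix m n ℝ := Matrix.of fun i j => if B i j then (1 : ℝ) else 0 with hRdef
  rw [Matrix.rank, finrank_eq_one_iff'] at hr
  obtain ⟨v, -, hv⟩ := hr
  have key : ∀ j, ∃ c : ℝ, ∀ i, R i j = c * (v : m → ℝ) i := by
    intro j
    obtain ⟨c, hc⟩ := hv ⟨R.mulVecLin (Pi.single j 1), LinearMap.mem_range_self _ _⟩
    refine ⟨c, fun i => ?_⟩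
    have := congrFun (congrArg Subtype.val hc) i
    simpa using this.symm
  choose c hc using key
  refine ⟨fun i => (v : m → ℝ) i ≠ 0, fun j => c j ≠ 0, ?_⟩
  ext i j
  have h01 : R i j = 0 ∨ R i j = 1 := by
    by_cases h : B i j = true <;> simp [hRdef, h]
  have hij := hc j i
  by_cases h1 : (v : m → ℝ) i = 0
  · simp [vecMulVec_apply, h1, hij]
  by_cases h2 : c j = 0
  · simp [vecMulVec_apply, h2, hij]
  have : R i j ≠ 0 := hij ▸ mul_ne_zero h2 h1
  simpa [vecMulVec_apply, h1, h2] using h01.resolve_left this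

lemma frob_vecMulVec_le_one {m n : Type*} [Fintype m] [Fintype n] {X : Matrix m n ℝ}
    (hX : ∀ R ∈ rankOne01 m n, frob X R ≤ 1) {x : m → ℝ} {y : n → ℝ}
    (hx0 : ∀ i, 0 ≤ x i) (hx1 : ∀ i, x i ≤ 1) (hy0 : ∀ j, 0 ≤ y j) (hy1 : ∀ j, y j ≤ 1) :
    frob X (vecMulVec x y) ≤ 1 := by
  obtain ⟨p, hp⟩ := exists_vertex_ge (fun i => ∑ j, X i j * y j) x hx0 hx1
  obtain ⟨q, hq⟩ := exists_vertex_ge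
    (fun j => ∑ i, X i j * (if p i then (1 : ℝ) else 0)) y hy0 hy1
  rw [← frob_vecMulVec, ← frob_vecMulVec] at hp
  rw [← frob_vecMulVec', ← frob_vecMulVec'] at hq
  refine hp.trans (hq.trans ?_)
  by_cases hp_ex : ∃ i, p i
  · by_cases hq_ex : ∃ j, q j
    · obtain ⟨i, hi⟩ := hp_ex
      obtain ⟨j, hj⟩ := hq_ex
      exact hX _ (vecMulVec_indicator_mem_rankOne01 p q hi hj)
    · push Not at hq_ex
      simp [frob, vecMulVec_apply, hq_ex]
  · push Not at hp_ex
    simp [frob, vecMulVec_apply, hp_ex]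

/-- Feasibility for the hyperplane separation bound is preserved under diagonal scalings with
entries in `[0,1]`. -/
lemma frob_diagonal_scaling_le_one {m n : Type*} [Fintype m] [Fintype n]
    [DecidableEq m] [DecidableEq n] {X : Matrix m n ℝ}
    (hX : ∀ R ∈ rankOne01 m n, frob X R ≤ 1) {x : m → ℝ} {y : n → ℝ}
    (hx0 : ∀ i, 0 ≤ x i) (hx1 : ∀ i, x i ≤ 1) (hy0 : ∀ j, 0 ≤ y j) (hy1 : ∀ j, y j ≤ 1) :
    ∀ R ∈ rankOne01 m n, frob (diagonal x * X * diagonal y) R ≤ 1 := by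
  intro R hR
  obtain ⟨p, q, rfl⟩ := exists_eq_vecMulVec_of_mem_rankOne01 hR
  rw [frob_diagonal_mul_mul_diagonal, mul_vecMulVec, vecMulVec_mul]
  apply frob_vecMulVec_le_one hX <;> intro i <;>
    simp only [mulVec_diagonal, vecMul_diagonal] <;> split_ifs <;> simp [hx0, hx1, hy0, hy1]

/-- The unnormalized hyperplane separation bound. -/
noncomputable def hsbSup {m n : Type*} [Fintype m] [Fintype n] (S : Matrix m n ℝ) : ℝ :=
  sSup {t : ℝ | ∃ X : Matrix m n ℝ, (∀ R ∈ rankOne01 m n, frob X R ≤ 1) ∧ t = frob S X}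

lemma hsb_eq {m n : Type*} [Fintype m] [Fintype n] (S : Matrix m n ℝ) :
    hsb S = (mnorm S)⁻¹ * hsbSup S := rfl

lemma entry_le_one {m n : Type*} [Fintype m] [Fintype n] {X : Matrix m n ℝ}
    (hX : ∀ R ∈ rankOne01 m n, frob X R ≤ 1) (i : m) (j : n) : X i j ≤ 1 := by
  have h := hX _ (vecMulVec_indicator_mem_rankOne01 (· = i) (· = j) rfl rfl)
  simpa [frob_vecMulVec] using h

lemma frob_le_hsbSup {m n : Type*} [Fintype m] [Fintype n] {S X : Matrix m n ℝ}
    (hS : ∀ i j, 0 ≤ S i j) (hX : ∀ R ∈ rankOne01 m n, frob X R ≤ 1) :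
    frob S X ≤ hsbSup S := by
  refine le_csSup ⟨∑ i, ∑ j, S i j, ?_⟩ ⟨X, hX, rfl⟩
  rintro _ ⟨Y, hY, rfl⟩
  exact Finset.sum_le_sum fun i _ => Finset.sum_le_sum fun j _ =>
    mul_le_of_le_one_right (hS i j) (entry_le_one hY i j)

lemma hsbSup_diagonal_scaling_le {m n : Type*} [Fintype m] [Fintype n]
    [DecidableEq m] [DecidableEq n] {S : Matrix m n ℝ} (hS : ∀ i j, 0 ≤ S i j)
    {d : m → ℝ} {e : n → ℝ} (hd : ∀ i, 0 ≤ d i) (he : ∀ j, 0 ≤ e j) {a b : ℝ}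
    (ha : 0 < a) (hb : 0 < b) (hda : ∀ i, d i ≤ a) (heb : ∀ j, e j ≤ b) :
    hsbSup (diagonal d * S * diagonal e) ≤ a * b * hsbSup S := by
  refine csSup_le ⟨0, 0, fun R _ => by simp [frob], by simp [frob]⟩ ?_
  rintro _ ⟨X, hX, rfl⟩
  have hY := frob_diagonal_scaling_le_one hX
    (fun i => div_nonneg (hd i) ha.le) (fun i => (div_le_one ha).2 (hda i))
    (fun j => div_nonneg (he j) hb.le) (fun j => (div_le_one hb).2 (heb j))
  have h : diagonal d * X * diagonal e =
      (a * b) • (diagonal (fun i => d i / a) * X * diagonal (fun j => e j / b)) := by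
    ext i j
    simp only [mul_diagonal, diagonal_mul, Matrix.smul_apply, smul_eq_mul]
    field_simp
  rw [frob_diagonal_mul_mul_diagonal, h, frob_smul_right]
  exact mul_le_mul_of_nonneg_left (frob_le_hsbSup hS hY) (mul_pos ha hb).le

lemma inv_diagonal_of_pos {m : Type*} [Fintype m] [DecidableEq m] {d : m → ℝ}
    (hd : ∀ i, 0 < d i) : (diagonal d)⁻¹ = diagonal fun i => (d i)⁻¹ := by
  refine inv_eq_right_inv ?_
  rw [diagonal_mul_diagonal, ← diagonal_one]
  exact congrArg diagonal (funext fun i => mul_inv_cancel₀ (hd i).ne')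

/-- Bounds on the hyperplane separation bound of a positive diagonal scaling
`D₁ S D₂` of a nonnegative, not identically zero matrix `S`. -/
theorem hsb_diagonal_scaling {m n : ℕ}
    (S : Matrix (Fin m) (Fin n) ℝ) (hS : ∀ i j, 0 ≤ S i j) (hS0 : S ≠ 0)
    (d₁ : Fin m → ℝ) (d₂ : Fin n → ℝ) (hd₁ : ∀ i, 0 < d₁ i) (hd₂ : ∀ j, 0 < d₂ j) :
    mnorm S /
        (mnorm (Matrix.diagonal d₁)⁻¹ * mnorm (Matrix.diagonal d₁ * S * Matrix.diagonal d₂) *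
          mnorm (Matrix.diagonal d₂)⁻¹) * hsb S ≤
      hsb (Matrix.diagonal d₁ * S * Matrix.diagonal d₂) ∧
    hsb (Matrix.diagonal d₁ * S * Matrix.diagonal d₂) ≤
      hsb S * (mnorm (Matrix.diagonal d₁) * mnorm S * mnorm (Matrix.diagonal d₂)) /
        mnorm (Matrix.diagonal d₁ * S * Matrix.diagonal d₂) := by
  obtain ⟨i, j, hij⟩ : ∃ i j, S i j ≠ 0 := by
    by_contra! h
    exact hS0 (Matrix.ext h)
  set T := Matrix.diagonal d₁ * S * Matrix.diagonal d₂ with hT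
  have hTapply : ∀ i j, T i j = d₁ i * S i j * d₂ j := fun i j => by
    rw [hT, mul_diagonal, diagonal_mul]
  have hT0 : ∀ i j, 0 ≤ T i j := fun i j => by
    rw [hTapply]
    exact mul_nonneg (mul_nonneg (hd₁ i).le (hS i j)) (hd₂ j).le
  have hTij : T i j ≠ 0 := by
    rw [hTapply]
    exact mul_ne_zero (mul_ne_zero (hd₁ i).ne' hij) (hd₂ j).ne'
  have hST : S = diagonal (fun i => (d₁ i)⁻¹) * T * diagonal (fun j => (d₂ j)⁻¹) := by
    ext i j
    rw [mul_diagonal, diagonal_mul, hTapply]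
    have := (hd₁ i).ne'
    have := (hd₂ j).ne'
    field_simp
  have hi₁ : ∀ i, 0 < (d₁ i)⁻¹ := fun i => inv_pos.2 (hd₁ i)
  have hi₂ : ∀ j, 0 < (d₂ j)⁻¹ := fun j => inv_pos.2 (hd₂ j)
  rw [inv_diagonal_of_pos hd₁, inv_diagonal_of_pos hd₂, hsb_eq, hsb_eq]
  have hM : 0 < mnorm S := mnorm_pos hij
  have hN : 0 < mnorm T := mnorm_pos hTij
  have ha := (hd₁ i).trans_le (le_mnorm_diagonal d₁ i)
  have hb := (hd₂ j).trans_le (le_mnorm_diagonal d₂ j)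
  have ha' := (hi₁ i).trans_le (le_mnorm_diagonal (fun i => (d₁ i)⁻¹) i)
  have hb' := (hi₂ j).trans_le (le_mnorm_diagonal (fun j => (d₂ j)⁻¹) j)
  have upper : hsbSup T ≤ _ := hsbSup_diagonal_scaling_le hS (fun i => (hd₁ i).le)
    (fun j => (hd₂ j).le) ha hb (le_mnorm_diagonal d₁) (le_mnorm_diagonal d₂)
  have lower := hsbSup_diagonal_scaling_le hT0 (fun i => (hi₁ i).le)
    (fun j => (hi₂ j).le) ha' hb' (le_mnorm_diagonal _) (le_mnorm_diagonal _)
  rw [← hST] at lower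
  generalize mnorm (diagonal d₁) = a at *
  generalize mnorm (diagonal d₂) = b at *
  generalize mnorm (diagonal fun i => (d₁ i)⁻¹) = a' at *
  generalize mnorm (diagonal fun i => (d₂ i)⁻¹) = b' at *
  generalize mnorm S = M at *
  generalize mnorm T = N at *
  constructor
  · calc M / (a' * N * b') * (M⁻¹ * hsbSup S) = N⁻¹ * (hsbSup S / (a' * b')) := by field_simp
      _ ≤ N⁻¹ * hsbSup T := by
        refine mul_le_mul_of_nonneg_left ?_ (inv_pos.2 hN).le
        rw [div_le_iff₀ (mul_pos ha' hb')]
        linarith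
  · calc N⁻¹ * hsbSup T ≤ N⁻¹ * (a * b * hsbSup S) :=
        mul_le_mul_of_nonneg_left upper (inv_pos.2 hN).le
      _ = M⁻¹ * hsbSup S * (a * M * b) / N := by field_simp
end

section
/- For n ≥ 1 and a real number λ ≥ 1, let S_{n,λ} be the (n+1)×(n+1) matrix obtained from the identity matrix by multiplying its first row by λ (i.e., the diagonal matrix with diagonal entries λ, 1, 1, …, 1). Then hsb(S_{n,λ}) = n/λ + 1. -/
open scoped Classical
open Matrix BigOperators

theorem frob_diagonal_left {n : Type*} [Fintype n] [DecidableEq n] (d : n → ℝ) (X : Matrix n n ℝ) :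
    frob (Matrix.diagonal d) X = ∑ i, d i * X i i := by
  simp [frob, Matrix.diagonal_apply]

theorem eq_zero_or_one_of_mem_rankOne01 {m n : Type*} [Fintype m] [Fintype n]
    {R : Matrix m n ℝ} (hR : R ∈ rankOne01 m n) (i : m) (j : n) : R i j = 0 ∨ R i j = 1 := by
  obtain ⟨B, -, rfl⟩ := Finset.mem_image.mp (Finset.mem_filter.mp hR).1
  by_cases h : B i j <;> simp [h]

/-- The `2 × 2` minors of a matrix of rank at most one vanish. -/
theorem mul_eq_mul_of_rank_le_one {m n : Type*} [Fintype n] {R : Matrix m n ℝ}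
    (hR : R.rank ≤ 1) (i k : m) (j l : n) : R i j * R k l = R i l * R k j := by
  by_contra h
  have hdet : (R.submatrix ![i, k] ![j, l]).det ≠ 0 := by
    rw [Matrix.det_fin_two]
    simpa [-Matrix.submatrix_cons_row, sub_eq_zero] using h
  have h1 := Matrix.rank_of_det_ne_zero hdet
  have h2 := Matrix.rank_submatrix_le R ![i, k] ![j, l]
  simp only [Fintype.card_fin] at h1
  omega

theorem diagonal_single_mem_rankOne01 {n : Type*} [Fintype n] [DecidableEq n] (i : n) :
    Matrix.diagonal (Pi.single i (1 : ℝ)) ∈ rankOne01 n n := by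
  unfold rankOne01
  refine Finset.mem_filter.mpr ⟨Finset.mem_image.mpr
    ⟨Matrix.of fun a b => decide (a = b ∧ a = i), ?_, ?_⟩, ?_⟩
  · simp
  · ext a b
    by_cases hab : a = b <;> by_cases hai : a = i <;> simp_all
  · rw [Matrix.rank_diagonal]
    simp [Pi.single_apply]

theorem diag_le_one_of_frob_le_one {n : Type*} [Fintype n] {X : Matrix n n ℝ}
    (hX : ∀ R ∈ rankOne01 n n, frob X R ≤ 1) (i : n) : X i i ≤ 1 := by
  have h := hX _ (diagonal_single_mem_rankOne01 i)
  rw [frob_comm, frob_diagonal_left] at h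
  simpa [Pi.single_apply] using h

/-- A combinatorial rectangle meeting the diagonal in `d` cells has at least `d ^ 2` cells. -/
theorem sq_sum_diag_le_sum_of_mem_rankOne01 {n : Type*} [Fintype n] {R : Matrix n n ℝ}
    (hR : R ∈ rankOne01 n n) : (∑ i, R i i) ^ 2 ≤ ∑ i, ∑ j, R i j := by
  rw [sq, Finset.sum_mul_sum]
  refine Finset.sum_le_sum fun i _ => Finset.sum_le_sum fun j _ => ?_
  rw [mul_eq_mul_of_rank_le_one (Finset.mem_filter.mp hR).2.le]
  rcases eq_zero_or_one_of_mem_rankOne01 hR i j with h | h <;>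
    rcases eq_zero_or_one_of_mem_rankOne01 hR j i with h' | h' <;> norm_num [h, h']

/-- The matrix with ones on the diagonal and `-1` elsewhere is dual feasible. -/
theorem frob_two_diagonal_sub_one_le_one {n : Type*} [Fintype n] [DecidableEq n] {R : Matrix n n ℝ}
    (hR : R ∈ rankOne01 n n) :
    frob (Matrix.of fun i j => (if i = j then 2 else 0) - 1) R ≤ 1 := by
  have h : frob (Matrix.of fun i j => (if i = j then 2 else 0) - 1) R
      = 2 * (∑ i, R i i) - ∑ i, ∑ j, R i j := by
    simp [frob, sub_mul, Finset.sum_sub_distrib, Finset.mul_sum]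
  rw [h]
  nlinarith [sq_sum_diag_le_sum_of_mem_rankOne01 hR, sq_nonneg ((∑ i, R i i) - 1)]

theorem mnorm_diagonal_of_le {n : Type*} [Fintype n] [DecidableEq n] {d : n → ℝ} {i : n}
    (hd : ∀ j, |d j| ≤ |d i|) : mnorm (Matrix.diagonal d) = |d i| := by
  have hle : ∀ p : n × n, |Matrix.diagonal d p.1 p.2| ≤ |d i| := by
    rintro ⟨a, b⟩
    by_cases h : a = b <;> simp [h, hd]
  have : Nonempty (n × n) := ⟨(i, i)⟩
  refine le_antisymm (ciSup_le hle) ?_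
  simpa [mnorm] using le_ciSup (f := fun p : n × n => |Matrix.diagonal d p.1 p.2|)
    ⟨_, Set.forall_mem_range.mpr hle⟩ (i, i)

/-- For a nonnegative diagonal matrix the supremum in the hyperplane separation bound is
the trace. -/
theorem isGreatest_frob_diagonal {n : Type*} [Fintype n] [DecidableEq n] {d : n → ℝ} (hd : ∀ i, 0 ≤ d i) :
    IsGreatest {t : ℝ | ∃ X : Matrix n n ℝ,
      (∀ R ∈ rankOne01 n n, frob X R ≤ 1) ∧ t = frob (Matrix.diagonal d) X} (∑ i, d i) := by
  refine ⟨⟨_, fun R hR => frob_two_diagonal_sub_one_le_one hR, ?_⟩, ?_⟩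
  · rw [frob_diagonal_left]
    norm_num
  · rintro t ⟨X, hX, rfl⟩
    rw [frob_diagonal_left]
    exact Finset.sum_le_sum fun i _ =>
      mul_le_of_le_one_right (hd i) (diag_le_one_of_frob_le_one hX i)

/-- For the slack matrix `S_{n,λ}` of the `n`-simplex with one inequality rescaled by
`λ ≥ 1` (the `(n+1) × (n+1)` diagonal matrix with diagonal entries `λ, 1, …, 1`),
the hyperplane separation bound equals `n/λ + 1`. -/
theorem hsb_scaled_identity (n : ℕ) (hn : 1 ≤ n) (lam : ℝ) (hlam : 1 ≤ lam) :
    hsb (Matrix.diagonal (fun i : Fin (n + 1) => if i = 0 then lam else 1)) =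
      (n : ℝ) / lam + 1 := by
  have h0 : 0 < lam := by linarith
  set d : Fin (n + 1) → ℝ := fun i => if i = 0 then lam else 1 with hd
  have hnonneg : ∀ i, 0 ≤ d i := fun i => by
    simp only [hd]
    split_ifs <;> linarith
  have hnorm : mnorm (Matrix.diagonal d) = lam := by
    rw [mnorm_diagonal_of_le (i := 0) fun j => ?_, abs_of_nonneg (hnonneg 0)]
    · simp [hd]
    · rw [abs_of_nonneg (hnonneg j), abs_of_nonneg (hnonneg 0)]
      simp only [hd]
      split_ifs <;> simp_all
  have hsum : ∑ i, d i = lam + n := by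
    simp [hd, Fin.sum_univ_succ]
  rw [hsb, (isGreatest_frob_diagonal hnonneg).csSup_eq, hnorm, hsum]
  field_simp
  ring
end

section
/- Let A = (a_{ij}) be a symmetric nonnegative n×n real matrix and define g_A(S) = Σ_{i,j ∈ S, i ≤ j} a_{ij} for S ⊆ [n]. Let Z(A) := Σ_{j=1}^n a_{jj}·u^j + Σ_{1 ≤ i < j ≤ n} a_{ij}·[u^i, u^j] be the Minkowski sum of the points a_{jj}u^j and the line segments a_{ij}·[u^i,u^j], where u^i denotes the i-th canonical unit vector of ℝⁿ and [x,y] denotes the segment conv{x,y}. Then Z(A) = { x ∈ ℝⁿ : Σ_{i=1}^n x_i = g_A([n]), and Σ_{i ∈ S} x_i ≥ g_A(S) for all S ⊆ [n] }. -/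
open scoped Classical
open Matrix BigOperators

/-- The set function `g_A(S) = ∑_{i,j ∈ S, i ≤ j} a_{ij}` associated with a symmetric
nonnegative matrix `A`. -/
def gFun {n : ℕ} (A : Matrix (Fin n) (Fin n) ℝ) (S : Finset (Fin n)) : ℝ :=
  ∑ i ∈ S, ∑ j ∈ S, if i ≤ j then A i j else 0


/-- The minimum of the linear functional `c` over the graphic zonotope of `A`. -/
def minSupport {n : ℕ} (A : Matrix (Fin n) (Fin n) ℝ) (c : Fin n → ℝ) : ℝ :=
  ∑ i, ∑ j, if i ≤ j then A i j * min (c i) (c j) else 0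

lemma sum_ite_le_eq_diag_add {n : ℕ} (F : Fin n → Fin n → ℝ) :
    (∑ i, ∑ j, if i ≤ j then F i j else 0) =
      ∑ j, F j j + ∑ p ∈ Finset.univ.filter (fun p : Fin n × Fin n => p.1 < p.2), F p.1 p.2 := by
  rw [Finset.sum_filter, Fintype.sum_prod_type, ← Finset.sum_add_distrib]
  refine Finset.sum_congr rfl fun i _ => ?_
  have h : F i i = ∑ j, if i = j then F i j else 0 := by simp
  rw [h, ← Finset.sum_add_distrib]
  refine Finset.sum_congr rfl fun j _ => ?_
  rcases lt_trichotomy i j with h | h | h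
  · simp [h, h.le, h.ne]
  · simp [h]
  · simp [h.not_ge, h.ne', h.le]

lemma minSupport_indicator {n : ℕ} (A : Matrix (Fin n) (Fin n) ℝ) (S : Finset (Fin n)) :
    minSupport A (fun i => if i ∈ S then 1 else 0) = gFun A S := by
  unfold minSupport gFun
  rw [← Fintype.sum_ite_mem S]
  refine Finset.sum_congr rfl fun i _ => ?_
  by_cases hi : i ∈ S
  · rw [if_pos hi, ← Fintype.sum_ite_mem S]
    refine Finset.sum_congr rfl fun j _ => ?_
    by_cases hj : j ∈ S <;> simp [hi, hj]
  · rw [if_neg hi]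
    refine Finset.sum_eq_zero fun j _ => ?_
    by_cases hj : j ∈ S <;> simp [hi, hj]

lemma minSupport_const {n : ℕ} (A : Matrix (Fin n) (Fin n) ℝ) (r : ℝ) :
    minSupport A (fun _ => r) = r * gFun A Finset.univ := by
  simp only [minSupport, gFun, min_self, Finset.mul_sum, mul_ite, mul_zero, mul_comm _ r]

lemma integral_ite_lt {a b c : ℝ} (hac : a ≤ c) (hcb : c ≤ b) :
    IntervalIntegrable (fun t : ℝ => if t < c then (1 : ℝ) else 0) MeasureTheory.volume a b ∧
      ∫ t in a..b, (if t < c then (1 : ℝ) else 0) = c - a := by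
  have hanti : Antitone (fun t : ℝ => if t < c then (1 : ℝ) else 0) := by
    intro s t hst
    dsimp only
    split_ifs with h₁ h₂ <;> first | exact (h₂ (hst.trans_lt h₁)).elim | norm_num
  refine ⟨hanti.intervalIntegrable, ?_⟩
  rw [← intervalIntegral.integral_add_adjacent_intervals (b := c) hanti.intervalIntegrable
    hanti.intervalIntegrable]
  have h₁ : ∫ t in a..c, (if t < c then (1 : ℝ) else 0) = ∫ t in a..c, (1 : ℝ) := by
    refine intervalIntegral.integral_congr_ae ?_
    filter_upwards [MeasureTheory.Measure.ae_ne MeasureTheory.volume c] with t ht hmem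
    rw [Set.uIoc_of_le hac] at hmem
    rw [if_pos (lt_of_le_of_ne hmem.2 ht)]
  have h₂ : ∫ t in c..b, (if t < c then (1 : ℝ) else 0) = ∫ t in c..b, (0 : ℝ) := by
    refine intervalIntegral.integral_congr fun t ht => ?_
    rw [Set.uIcc_of_le hcb] at ht
    exact if_neg ht.1.not_gt
  rw [h₁, h₂]
  simp

/-- Every point of the base polytope satisfies all the linear inequalities of the zonotope, by
the layer-cake decomposition of the functional into indicators of its superlevel sets. -/
lemma minSupport_le_of_mem_basePolytope {n : ℕ} {A : Matrix (Fin n) (Fin n) ℝ} {x : Fin n → ℝ}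
    (hx : ∑ i, x i = gFun A Finset.univ) (hS : ∀ S : Finset (Fin n), gFun A S ≤ ∑ i ∈ S, x i)
    (c : Fin n → ℝ) : minSupport A c ≤ ∑ i, c i * x i := by
  obtain ⟨M, hM⟩ := (Set.finite_range c).bddAbove
  obtain ⟨m, hm⟩ := (Set.finite_range c).bddBelow
  have hcM i : c i ≤ M := hM ⟨i, rfl⟩
  have hmc i : m ≤ c i := hm ⟨i, rfl⟩
  rcases isEmpty_or_nonempty (Fin n) with hn | ⟨⟨i₀⟩⟩
  · simp [minSupport]
  have hmM : m ≤ M := (hmc i₀).trans (hcM i₀)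
  have hlayer i := integral_ite_lt (hmc i) (hcM i)
  have hlayer₂ i j := integral_ite_lt (le_min (hmc i) (hmc j)) ((min_le_left _ (c j)).trans (hcM i))
  have hint₁ : ∀ i ∈ Finset.univ, IntervalIntegrable
      (fun t : ℝ => (if t < c i then (1 : ℝ) else 0) * x i) MeasureTheory.volume m M :=
    fun i _ => (hlayer i).1.mul_const _
  have hint₂ : ∀ p ∈ Finset.univ.filter (fun p : Fin n × Fin n => p.1 ≤ p.2), IntervalIntegrable
      (fun t : ℝ => A p.1 p.2 * (if t < min (c p.1) (c p.2) then (1 : ℝ) else 0))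
      MeasureTheory.volume m M :=
    fun p _ => (hlayer₂ p.1 p.2).1.const_mul _
  have key : ∫ t in m..M, (∑ p ∈ Finset.univ.filter (fun p : Fin n × Fin n => p.1 ≤ p.2),
        A p.1 p.2 * (if t < min (c p.1) (c p.2) then (1 : ℝ) else 0)) ≤
      ∫ t in m..M, ∑ i, (if t < c i then (1 : ℝ) else 0) * x i := by
    refine intervalIntegral.integral_mono_on hmM 
      (by simpa only [Finset.sum_fn] using IntervalIntegrable.sum _ hint₂)
      (by simpa only [Finset.sum_fn] using IntervalIntegrable.sum _ hint₁) fun t _ => ?_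
    have h := hS (Finset.univ.filter fun i => t < c i)
    rw [← minSupport_indicator] at h
    convert h using 1
    · rw [minSupport, Finset.sum_filter, Fintype.sum_prod_type]
      refine Finset.sum_congr rfl fun i _ => Finset.sum_congr rfl fun j _ => ?_
      by_cases hi : t < c i <;> by_cases hj : t < c j <;> simp [hi, hj]
    · simp [Finset.sum_filter]
  rw [intervalIntegral.integral_finsetSum hint₁, intervalIntegral.integral_finsetSum hint₂] at key
  simp only [intervalIntegral.integral_mul_const, intervalIntegral.integral_const_mul,
    (hlayer _).2, (hlayer₂ _ _).2, sub_mul, mul_sub, Finset.sum_sub_distrib] at key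
  rw [← Finset.mul_sum, hx, Finset.sum_filter, Finset.sum_filter, Fintype.sum_prod_type,
    Fintype.sum_prod_type] at key
  have hconst := minSupport_const A m
  simp only [minSupport, min_self] at hconst
  unfold minSupport
  linarith

open Pointwise in
/-- The graphic zonotope of `A`. -/
def graphicZonotope {n : ℕ} (A : Matrix (Fin n) (Fin n) ℝ) : Set (Fin n → ℝ) :=
  ({∑ j, A j j • (Pi.single j (1 : ℝ) : Fin n → ℝ)} : Set (Fin n → ℝ)) +
    (∑ p ∈ Finset.univ.filter (fun p : Fin n × Fin n => p.1 < p.2),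
      A p.1 p.2 •
        segment ℝ (Pi.single p.1 (1 : ℝ) : Fin n → ℝ)
          (Pi.single p.2 (1 : ℝ) : Fin n → ℝ))

open Pointwise in
lemma convex_graphicZonotope {n : ℕ} (A : Matrix (Fin n) (Fin n) ℝ) :
    Convex ℝ (graphicZonotope A) :=
  (convex_singleton _).add <| convex_sum _ fun _ _ => (convex_segment _ _).smul _

open Pointwise in
lemma isCompact_graphicZonotope {n : ℕ} (A : Matrix (Fin n) (Fin n) ℝ) :
    IsCompact (graphicZonotope A) := by
  refine isCompact_singleton.add <| Finset.sum_induction _ IsCompact (fun _ _ => IsCompact.add)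
    isCompact_singleton fun _ _ => IsCompact.smul _ ?_
  rw [← convexHull_pair]
  exact (Set.toFinite _).isCompact_convexHull ℝ

lemma minSupport_le_of_mem_graphicZonotope {n : ℕ} {A : Matrix (Fin n) (Fin n) ℝ}
    (hnn : ∀ i j, 0 ≤ A i j) (f : (Fin n → ℝ) →ₗ[ℝ] ℝ) {z : Fin n → ℝ}
    (hz : z ∈ graphicZonotope A) : minSupport A (fun i => f (Pi.single i 1)) ≤ f z := by
  obtain ⟨_, rfl, y, hy, rfl⟩ := hz
  obtain ⟨g, hg, rfl⟩ := Set.mem_finsetSum _ _ _ |>.1 hy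
  rw [minSupport, sum_ite_le_eq_diag_add]
  simp only [min_self, map_add, map_sum, map_smul, smul_eq_mul]
  refine add_le_add_right (Finset.sum_le_sum fun p hp => ?_) _
  obtain ⟨_, ⟨a, b, ha, hb, hab, rfl⟩, hw⟩ := hg hp
  rw [← hw]
  simp only [map_add, map_smul, smul_eq_mul]
  refine mul_le_mul_of_nonneg_left ?_ (hnn _ _)
  simpa using convex_Ici (𝕜 := ℝ) (min (f (Pi.single p.1 1)) (f (Pi.single p.2 1)))
    (Set.mem_Ici.2 (min_le_left _ _)) (Set.mem_Ici.2 (min_le_right _ _)) ha hb hab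

lemma exists_mem_graphicZonotope_eq_minSupport {n : ℕ} (A : Matrix (Fin n) (Fin n) ℝ)
    (f : (Fin n → ℝ) →ₗ[ℝ] ℝ) :
    ∃ z ∈ graphicZonotope A, f z = minSupport A (fun i => f (Pi.single i 1)) := by
  let v (p : Fin n × Fin n) : Fin n → ℝ :=
    if f (Pi.single p.1 1) ≤ f (Pi.single p.2 1) then Pi.single p.1 1 else Pi.single p.2 1
  refine ⟨_, Set.add_mem_add rfl (Set.finsetSum_mem_finsetSum _ _ (fun p => A p.1 p.2 • v p)
    fun p _ => Set.smul_mem_smul_set ?_), ?_⟩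
  · unfold v
    split_ifs
    · exact left_mem_segment _ _ _
    · exact right_mem_segment _ _ _
  · rw [minSupport, sum_ite_le_eq_diag_add]
    simp only [min_self, map_add, map_sum, map_smul, smul_eq_mul, v, apply_ite f, min_def]

lemma linearMap_pi_apply {n : ℕ} (f : (Fin n → ℝ) →ₗ[ℝ] ℝ) (x : Fin n → ℝ) :
    f x = ∑ i, f (Pi.single i 1) * x i := by
  conv_lhs => rw [pi_eq_sum_univ' x]
  simp only [map_sum, map_smul, smul_eq_mul, mul_comm]

open Pointwise in
/-- The graphic zonotope
`Z(A) = ∑_j a_{jj} u^j + ∑_{i<j} a_{ij} [u^i, u^j]` coincides with the supermodular base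
polytope `{ x : ∑ᵢ xᵢ = g_A([n]), x(S) ≥ g_A(S) for all S ⊆ [n] }`. -/
theorem graphicZonotope_eq_basePolytope {n : ℕ} (A : Matrix (Fin n) (Fin n) ℝ)
    (hsymm : A.IsSymm) (hnn : ∀ i j, 0 ≤ A i j) :
    ({∑ j, A j j • (Pi.single j (1 : ℝ) : Fin n → ℝ)} : Set (Fin n → ℝ)) +
        (∑ p ∈ Finset.univ.filter (fun p : Fin n × Fin n => p.1 < p.2),
          A p.1 p.2 •
            segment ℝ (Pi.single p.1 (1 : ℝ) : Fin n → ℝ)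
              (Pi.single p.2 (1 : ℝ) : Fin n → ℝ)) =
      {x : Fin n → ℝ | (∑ i, x i) = gFun A Finset.univ ∧
        ∀ S : Finset (Fin n), gFun A S ≤ ∑ i ∈ S, x i} := by
  change graphicZonotope A = _
  ext x
  constructor
  · intro hx
    have h (c : Fin n → ℝ) : minSupport A c ≤ ∑ i, c i * x i := by
      simpa [Fintype.linearCombination_apply, mul_comm, Pi.single_apply] using
        minSupport_le_of_mem_graphicZonotope hnn (Fintype.linearCombination ℝ c) hx
    refine ⟨le_antisymm ?_ ?_, fun S => ?_⟩
    · have := h fun _ => -1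
      rw [minSupport_const, ← Finset.mul_sum] at this
      linarith
    · simpa [minSupport_const] using h fun _ => 1
    · simpa [minSupport_indicator] using h fun i => if i ∈ S then 1 else 0
  · rintro ⟨hx, hS⟩
    by_contra hxZ
    obtain ⟨f, u, hfx, hfZ⟩ := geometric_hahn_banach_point_closed (convex_graphicZonotope A)
      (isCompact_graphicZonotope A).isClosed hxZ
    obtain ⟨z, hz, hfz⟩ := exists_mem_graphicZonotope_eq_minSupport A f.toLinearMap
    have hle := minSupport_le_of_mem_basePolytope hx hS fun i => f.toLinearMap (Pi.single i 1)
    rw [← linearMap_pi_apply, ← hfz] at hle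
    exact absurd (hfZ z hz) (not_lt.2 (hle.trans hfx.le))
end
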